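/- Fix reals λ_s > 0, λ > 0, a real α with 0 ≤ α < 1/2, and a real c > 0. Then there exist a constant c' > 0 and a positive integer N such that for all integers n ≥ N, if n_0 = ⌈n^{1−α}/c⌉ satisfies n_0 ≤ n, then the ring age satisfies D(n_0) ≥ c'·(λ_s/λ)·√n. (This is the lower bound Ω(√n) on the version age of the equidistantly jammed ring, the least harmful placement of ⌈c·n^α⌉ jammers, when α < 1/2.) -/

import Mathlib

/-- Per-node long-term expected version age `D(m)` of an `m`-node mini-ring
(source self-update rate `lamS`, source-to-node rate `lam/n`, neighbor rate `lam/2`). -/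
noncomputable def ringAge (lamS lam : ℝ) (n m : ℕ) : ℝ :=
  (lamS / lam) *
    ((∑ j ∈ Finset.Icc 1 (m - 1), ∏ k ∈ Finset.Icc 1 j, (1 / ((k : ℝ) / n + 1)))
      + ((n : ℝ) / m) * ∏ k ∈ Finset.Icc 1 (m - 1), (1 / ((k : ℝ) / n + 1)))

/-- The first `⌊√n⌋` partial products of `1 / (k / n + 1)` stay above `exp (-1)`. -/
lemma exp_neg_one_le_prod_one_div {n j : ℕ} (hn : 0 < n) (hj : j ≤ Nat.sqrt n) :
    Real.exp (-1) ≤ ∏ k ∈ Finset.Icc 1 j, (1 / ((k : ℝ) / n + 1)) := by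
  have hn' : (0 : ℝ) < n := by exact_mod_cast hn
  have hjj : (j : ℝ) * j ≤ n := by
    exact_mod_cast (Nat.mul_le_mul hj hj).trans (Nat.sqrt_le n)
  calc Real.exp (-1) ≤ Real.exp (-((j : ℝ) / n)) ^ j := by
        rw [← Real.exp_nat_mul, Real.exp_le_exp, mul_neg, neg_le_neg_iff, ← mul_div_assoc,
          div_le_one hn']
        exact hjj
    _ = ∏ _k ∈ Finset.Icc 1 j, Real.exp (-((j : ℝ) / n)) := by simp
    _ ≤ ∏ k ∈ Finset.Icc 1 j, (1 / ((k : ℝ) / n + 1)) := by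
        refine Finset.prod_le_prod (fun _ _ => (Real.exp_pos _).le) fun k hk => ?_
        have hkj : (k : ℝ) ≤ j := by exact_mod_cast (Finset.mem_Icc.mp hk).2
        rw [Real.exp_neg, ← one_div]
        refine one_div_le_one_div_of_le (by positivity) ?_
        calc (k : ℝ) / n + 1 ≤ (j : ℝ) / n + 1 := by gcongr
          _ ≤ Real.exp ((j : ℝ) / n) := Real.add_one_le_exp _

/-- A mini-ring with more than `⌊√n⌋` nodes has version age at least of order `√n`. -/
lemma sqrt_le_ringAge {lamS lam : ℝ} (hlamS : 0 < lamS) (hlam : 0 < lam) {n m : ℕ} (hn : 0 < n)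
    (hm : Nat.sqrt n + 1 ≤ m) :
    Real.exp (-1) / 2 * (lamS / lam) * Real.sqrt n ≤ ringAge lamS lam n m := by
  have hs : 0 < Nat.sqrt n := Nat.sqrt_pos.mpr hn
  have hs1 : (1 : ℝ) ≤ Nat.sqrt n := by exact_mod_cast hs
  have hsqrt : Real.sqrt n ≤ 2 * Nat.sqrt n := by
    linarith [Real.real_sqrt_le_nat_sqrt_succ (a := n)]
  have hsum : (Nat.sqrt n : ℝ) * Real.exp (-1) ≤
      ∑ j ∈ Finset.Icc 1 (m - 1), ∏ k ∈ Finset.Icc 1 j, (1 / ((k : ℝ) / n + 1)) := by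
    calc (Nat.sqrt n : ℝ) * Real.exp (-1)
        = ∑ _j ∈ Finset.Icc 1 (Nat.sqrt n), Real.exp (-1) := by simp
      _ ≤ ∑ j ∈ Finset.Icc 1 (Nat.sqrt n), ∏ k ∈ Finset.Icc 1 j, (1 / ((k : ℝ) / n + 1)) :=
          Finset.sum_le_sum fun j hj =>
            exp_neg_one_le_prod_one_div hn (Finset.mem_Icc.mp hj).2
      _ ≤ _ := by
          refine Finset.sum_le_sum_of_subset_of_nonneg
            (Finset.Icc_subset_Icc_right (by omega)) fun j _ _ => ?_
          positivity
  have hlast : 0 ≤ ((n : ℝ) / m) * ∏ k ∈ Finset.Icc 1 (m - 1), (1 / ((k : ℝ) / n + 1)) := by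
    positivity
  have hexp : Real.exp (-1) / 2 * Real.sqrt n ≤ Nat.sqrt n * Real.exp (-1) := by
    linarith [mul_le_mul_of_nonneg_left hsqrt (Real.exp_pos (-1)).le]
  calc Real.exp (-1) / 2 * (lamS / lam) * Real.sqrt n
      = lamS / lam * (Real.exp (-1) / 2 * Real.sqrt n) := by ring
    _ ≤ ringAge lamS lam n m :=
        mul_le_mul_of_nonneg_left (by linarith) (div_pos hlamS hlam).le

/-- If `α < 1 / 2` then `⌈n ^ (1 - α) / c⌉` eventually exceeds `⌊√n⌋`. -/
lemma eventually_natSqrt_succ_le_ceil {α c : ℝ} (hα : α < 1 / 2) (hc : 0 < c) :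
    ∀ᶠ n : ℕ in Filter.atTop, Nat.sqrt n + 1 ≤ ⌈(n : ℝ) ^ (1 - α) / c⌉₊ := by
  have hlim := (tendsto_rpow_atTop (show 0 < 1 / 2 - α by linarith)).comp
    (tendsto_natCast_atTop_atTop (R := ℝ))
  filter_upwards [hlim.eventually_ge_atTop (2 * c), Filter.eventually_ge_atTop 1] with n hbig hn
  have hn1 : (1 : ℝ) ≤ n := by exact_mod_cast hn
  have hsqrt1 : 1 ≤ Real.sqrt n := Real.one_le_sqrt.mpr hn1
  have hpow : (n : ℝ) ^ (1 - α) = (n : ℝ) ^ (1 / 2 - α) * Real.sqrt n := by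
    rw [Real.sqrt_eq_rpow, ← Real.rpow_add (by linarith)]
    congr 1
    ring
  have hreal : ((Nat.sqrt n + 1 : ℕ) : ℝ) ≤ (n : ℝ) ^ (1 - α) / c := by
    rw [le_div_iff₀ hc, hpow]
    push_cast
    calc ((Nat.sqrt n : ℝ) + 1) * c ≤ (Real.sqrt n + Real.sqrt n) * c := by
          gcongr
          exact Real.nat_sqrt_le_real_sqrt
      _ = 2 * c * Real.sqrt n := by ring
      _ ≤ (n : ℝ) ^ (1 / 2 - α) * Real.sqrt n :=
          mul_le_mul_of_nonneg_right hbig (Real.sqrt_nonneg _)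
  exact_mod_cast hreal.trans (Nat.le_ceil _)

/-- For `0 ≤ α < 1/2` and `c > 0`: the version age of the equidistantly
jammed ring (mini-rings of size `n0 = ⌈n^{1−α}/c⌉`) is `Ω(√n)`. -/
theorem equidistant_jammed_ring_age_lower_bound_small_alpha
    (lamS lam : ℝ) (hlamS : 0 < lamS) (hlam : 0 < lam)
    (α : ℝ) (hα0 : 0 ≤ α) (hα : α < 1 / 2) (c : ℝ) (hc : 0 < c) :
    ∃ c' : ℝ, 0 < c' ∧ ∃ N : ℕ, 0 < N ∧ ∀ n : ℕ, N ≤ n →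
      ⌈(n : ℝ) ^ (1 - α) / c⌉₊ ≤ n →
      c' * (lamS / lam) * Real.sqrt n ≤ ringAge lamS lam n ⌈(n : ℝ) ^ (1 - α) / c⌉₊ := by
  obtain ⟨N, hN⟩ := Filter.eventually_atTop.mp (eventually_natSqrt_succ_le_ceil hα hc)
  refine ⟨Real.exp (-1) / 2, by positivity, N + 1, N.succ_pos, fun n hn _ => ?_⟩
  exact sqrt_le_ringAge hlamS hlam (by omega) (hN n (by omega))
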